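/- Let z ∈ [0,1] and let (Z_n) be the BEC Bhattacharyya process with initial value z. Let α ∈ (0,1), let ρ ≤ 1/2, and let c₁ > 0. Assume that for every n ≥ 1, E[(Z_n(1 − Z_n))^α] ≤ c₁·2^(−nρ). Then for every ν > 0 and every n ≥ 1, P(Z_n ≤ 2^(−n(ν+1))) ≥ (1 − z) − c₄·2^(−n(ρ − (ν+1)α)), where c₄ = √2 + 2c₁. -/

import Mathlib

open scoped Classical

/-- One polarization step for the Bhattacharyya parameter of a BEC. -/
noncomputable def becStep (z : ℝ) (b : Bool) : ℝ := if b then z ^ 2 else 2 * z - z ^ 2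

/-- `becF n b z` is the Bhattacharyya parameter of the synthetic channel indexed by the
binary string `b` obtained by polarizing a BEC with erasure probability `z`. -/
noncomputable def becF (n : ℕ) (b : Fin n → Bool) (z : ℝ) : ℝ :=
  (List.ofFn b).foldl becStep z

theorem becF_cons (n : ℕ) (a : Bool) (b : Fin n → Bool) (z : ℝ) :
    becF (n + 1) (Fin.cons a b) z = becF n b (becStep z a) := by
  simp [becF, List.ofFn_succ]

theorem becStep_mem (z : ℝ) (hz : z ∈ Set.Icc (0:ℝ) 1) (a : Bool) :
    becStep z a ∈ Set.Icc (0:ℝ) 1 := by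
  obtain ⟨h0, h1⟩ := hz
  cases a
  · simp only [becStep, Bool.false_eq_true, if_false, Set.mem_Icc]
    constructor <;> nlinarith
  · simp only [becStep, if_true, Set.mem_Icc]
    constructor <;> nlinarith

theorem becF_mem (n : ℕ) (b : Fin n → Bool) (z : ℝ) (hz : z ∈ Set.Icc (0:ℝ) 1) :
    becF n b z ∈ Set.Icc (0:ℝ) 1 := by
  induction n generalizing z with
  | zero => simpa [becF] using hz
  | succ n ih =>
    rw [← Fin.cons_self_tail b, becF_cons]
    exact ih _ _ (becStep_mem z hz _)

theorem becF_sum (n : ℕ) (z : ℝ) : ∑ b : Fin n → Bool, becF n b z = 2 ^ n * z := by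
  induction n generalizing z with
  | zero => simp [becF]
  | succ n ih =>
    rw [← (Fin.consEquiv (fun _ : Fin (n + 1) => Bool)).sum_comp, Fintype.sum_prod_type]
    simp only [Fin.consEquiv, Equiv.coe_fn_mk, becF_cons, ih, Fintype.sum_bool]
    simp only [becStep, if_true, Bool.false_eq_true, if_false]
    ring

theorem bec_pointwise (Z ε α : ℝ) (hZ : Z ∈ Set.Icc (0:ℝ) 1) (h0 : 0 < ε) (h1 : ε ≤ 1 / 2)
    (hα : α ∈ Set.Ioo (0:ℝ) 1) :
    1 - Z ≤ (if Z ≤ ε then (1:ℝ) else 0) + ε + 2 * ε ^ (-α) * (Z * (1 - Z)) ^ α := by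
  obtain ⟨hZ0, hZ1⟩ := hZ
  have hp : 0 ≤ (Z * (1 - Z)) ^ α :=
    Real.rpow_nonneg (mul_nonneg hZ0 (by linarith)) _
  have he : 0 < ε ^ (-α) := Real.rpow_pos_of_pos h0 _
  have hm : 0 ≤ 2 * ε ^ (-α) * (Z * (1 - Z)) ^ α := by positivity
  split_ifs with h
  · linarith
  · push Not at h
    by_cases hc : 1 - ε ≤ Z
    · linarith
    · push Not at hc
      have hb : ε * (1 / 2) ≤ Z * (1 - Z) := by nlinarith
      have h2 : (ε * (1 / 2)) ^ α ≤ (Z * (1 - Z)) ^ α :=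
        Real.rpow_le_rpow (by positivity) hb hα.1.le
      rw [Real.mul_rpow h0.le (by norm_num)] at h2
      have h3 : (1 / 2 : ℝ) ≤ (1 / 2 : ℝ) ^ α := by
        have := Real.rpow_le_rpow_of_exponent_ge (x := (1 / 2 : ℝ)) (by norm_num) (by norm_num)
          hα.2.le
        rwa [Real.rpow_one] at this
      have h4 : ε ^ (-α) * ε ^ α = 1 := by
        rw [← Real.rpow_add h0]; simp
      have h5 : 0 < ε ^ α := Real.rpow_pos_of_pos h0 _
      have h6 : ε ^ α * (1 / 2) ≤ (Z * (1 - Z)) ^ α :=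
        (mul_le_mul_of_nonneg_left h3 h5.le).trans h2
      have h7 := mul_le_mul_of_nonneg_left h6 he.le
      nlinarith

/-- **From expectation to polynomially small error probability (BEC).**
Let `(Z_n)` be the BEC Bhattacharyya process with initial value `z ∈ [0,1]`.  If for
every `n ≥ 1` one has `E[(Z_n(1 − Z_n))^α] ≤ c₁·2^(−nρ)` for some `α ∈ (0,1)` and
`ρ ≤ 1/2`, then for every `ν > 0` and every `n ≥ 1`,
`P(Z_n ≤ 2^(−n(ν+1))) ≥ (1 − z) − c₄·2^(−n(ρ − (ν+1)α))` with `c₄ = √2 + 2c₁`.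
Expectations and probabilities are uniform averages over the `2^n` binary strings
of length `n`. -/
theorem bec_expectation_to_polynomial_decay
    (z : ℝ) (hz : z ∈ Set.Icc (0:ℝ) 1)
    (α : ℝ) (hα : α ∈ Set.Ioo (0:ℝ) 1)
    (ρ : ℝ) (hρ : ρ ≤ 1/2)
    (c₁ : ℝ) (hc₁ : 0 < c₁)
    (hE : ∀ n : ℕ, 1 ≤ n →
      (∑ b : Fin n → Bool, (becF n b z * (1 - becF n b z)) ^ α) / 2 ^ n
        ≤ c₁ * (2:ℝ) ^ (-(n:ℝ) * ρ)) :
    ∀ ν : ℝ, 0 < ν → ∀ n : ℕ, 1 ≤ n →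
      (1 - z) - (Real.sqrt 2 + 2 * c₁) * (2:ℝ) ^ (-(n:ℝ) * (ρ - (ν + 1) * α)) ≤
        ((Finset.univ.filter
            (fun b : Fin n → Bool => becF n b z ≤ (2:ℝ) ^ (-(n:ℝ) * (ν + 1)))).card : ℝ)
          / 2 ^ n := by
  intro ν hν n hn
  have hn' : (1:ℝ) ≤ n := by exact_mod_cast hn
  set ε : ℝ := (2:ℝ) ^ (-(n:ℝ) * (ν + 1)) with hε
  have h0 : 0 < ε := Real.rpow_pos_of_pos (by norm_num) _
  have h1 : ε ≤ 1 / 2 := by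
    have : ε ≤ (2:ℝ) ^ (-1:ℝ) :=
      Real.rpow_le_rpow_of_exponent_le (by norm_num) (by nlinarith)
    rw [Real.rpow_neg_one] at this
    linarith
  have hα0 := hα.1
  set K : ℝ := (2:ℝ) ^ (-(n:ℝ) * (ρ - (ν + 1) * α)) with hK
  have hK0 : 0 < K := Real.rpow_pos_of_pos (by norm_num) _
  have hKe : ε ^ (-α) * (2:ℝ) ^ (-(n:ℝ) * ρ) = K := by
    rw [hε, hK, ← Real.rpow_mul (by norm_num), ← Real.rpow_add (by norm_num)]
    congr 1; ring
  have hεK : ε ≤ K := by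
    apply Real.rpow_le_rpow_of_exponent_le (by norm_num)
    have : 0 < (ν + 1) * α := by positivity
    nlinarith
  have hs : (1:ℝ) ≤ Real.sqrt 2 := by
    rw [Real.one_le_sqrt]; norm_num
  have hsum := Finset.sum_le_sum (s := (Finset.univ : Finset (Fin n → Bool)))
    (fun b _ => bec_pointwise (becF n b z) ε α (becF_mem n b z hz) h0 h1 hα)
  rw [Finset.sum_sub_distrib, becF_sum, Finset.sum_add_distrib, Finset.sum_add_distrib,
    ← Finset.mul_sum, Finset.sum_boole] at hsum
  simp only [Finset.sum_const, Finset.card_univ, Fintype.card_fun, Fintype.card_bool,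
    Fintype.card_fin, nsmul_eq_mul, Nat.cast_pow, Nat.cast_ofNat, mul_one] at hsum
  have hEn := hE n hn
  have hN : (0:ℝ) < 2 ^ n := by positivity
  rw [div_le_iff₀ hN] at hEn
  rw [le_div_iff₀ hN]
  have he : 0 < ε ^ (-α) := Real.rpow_pos_of_pos h0 _
  have h8 := mul_le_mul_of_nonneg_left hEn (by positivity : 0 ≤ 2 * ε ^ (-α))
  have h9 : 2 * ε ^ (-α) * (c₁ * (2:ℝ) ^ (-(n:ℝ) * ρ) * 2 ^ n) = 2 * c₁ * K * 2 ^ n := by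
    rw [← hKe]; ring
  rw [h9] at h8
  have h10 : ε ≤ Real.sqrt 2 * K := by nlinarith
  have h11 := mul_le_mul_of_nonneg_left h10 hN.le
  linarith
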